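/- For k ≥ 3, no (n,k) piggybacking code with t substripes over any finite field achieves perfect bandwidth k+t−1 in the 'any d' regime, i.e., there is no piggybacking code such that for every failed node i* and every repair set S of size k+t−1 avoiding i*, there is a linear repair scheme of bandwidth k+t−1. -/

import Mathlib

open Matrix

/-- `G` generates an MDS code: any `k` columns of `G` are linearly independent. -/
def IsMDS {n k : ℕ} {K : Type*} [Field K] (G : Matrix (Fin k) (Fin n) K) : Prop :=
  ∀ s : Finset (Fin n), s.card = k →
    LinearIndependent K (fun j : s => fun r : Fin k => G r j.1)

/-- Membership in the dual of the piggybacking code (with base generator `G` and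
piggybacking matrices `P i j`, used for `i < j`), via the column characterization. -/
def PiggyDual {n t k : ℕ} {K : Type*} [Field K] [Fintype K]
    (G : Matrix (Fin k) (Fin n) K) (P : Fin t → Fin t → Matrix (Fin k) (Fin n) K)
    (W : Matrix (Fin n) (Fin t) K) : Prop :=
  ∀ i : Fin t,
    G *ᵥ (fun r => W r i) + ∑ j ∈ Finset.Ioi i, (P i j) *ᵥ (fun r => W r j) = 0

section helpers

lemma mds_zero {n k : ℕ} {K : Type*} [Field K] {G : Matrix (Fin k) (Fin n) K} (h : IsMDS G)
    (hkn : k ≤ n) (y : Fin n → K) (hy : G *ᵥ y = 0) (s : Finset (Fin n)) (hs : s.card ≤ k)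
    (hsupp : ∀ r, r ∉ s → y r = 0) : y = 0 := by
  obtain ⟨s', hss, hc⟩ := Finset.exists_superset_card_eq hs (by simpa using hkn)
  have hl := Fintype.linearIndependent_iff.1 (h s' hc) (fun j => y j.1) (by
    funext r
    have h1 := congrFun hy r
    simp only [Matrix.mulVec, dotProduct, Pi.zero_apply] at h1
    simp only [Finset.sum_apply, Pi.smul_apply, smul_eq_mul, Pi.zero_apply]
    rw [← h1, Finset.sum_coe_sort s' (fun j => y j * G r j)]
    rw [Finset.sum_subset (Finset.subset_univ s')]
    · exact Finset.sum_congr rfl fun x _ => mul_comm _ _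
    · intro x _ hx
      rw [hsupp x (fun hxs => hx (hss hxs)), zero_mul])
  funext r
  by_cases hr : r ∈ s'
  · exact hl ⟨r, hr⟩
  · exact hsupp r fun hxs => hr (hss hxs)

lemma exists_ker {n k : ℕ} {K : Type*} [Field K] (G : Matrix (Fin k) (Fin n) K)
    (E : Finset (Fin n)) (hE : k < E.card) :
    ∃ y : Fin n → K, y ≠ 0 ∧ G *ᵥ y = 0 ∧ ∀ r, r ∉ E → y r = 0 := by
  classical
  let ext : (E → K) →ₗ[K] (Fin n → K) :=
    LinearMap.pi fun r => if hr : r ∈ E then LinearMap.proj (⟨r, hr⟩ : E) else 0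
  have hker : LinearMap.ker (G.mulVecLin ∘ₗ ext) ≠ ⊥ := by
    apply LinearMap.ker_ne_bot_of_finrank_lt
    simpa using hE
  obtain ⟨g, hg, hg0⟩ := (Submodule.ne_bot_iff _).1 hker
  refine ⟨ext g, ?_, ?_, ?_⟩
  · intro h0
    apply hg0
    funext e
    have := congrFun h0 e.1
    simpa [ext] using this
  · simpa using hg
  · intro r hr
    simp [ext, hr]

lemma piggy_zero {n t k : ℕ} {K : Type*} [Field K] [Fintype K]
    {G : Matrix (Fin k) (Fin n) K} (h : IsMDS G) (hkn : k ≤ n)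
    {P : Fin t → Fin t → Matrix (Fin k) (Fin n) K} {W : Matrix (Fin n) (Fin t) K}
    (hW : PiggyDual G P W) (s : Finset (Fin n)) (hs : s.card ≤ k)
    (hsupp : ∀ r, r ∉ s → W r = 0) : W = 0 := by
  have key : ∀ i : Fin t, (fun r => W r i) = 0 := by
    intro i
    induction i using WellFoundedGT.induction with
    | _ i ih =>
      have h1 := hW i
      rw [Finset.sum_eq_zero, add_zero] at h1
      · exact mds_zero h hkn _ h1 s hs fun r hr => by rw [hsupp r hr]; rfl
      · intro j hj
        rw [ih j (Finset.mem_Ioi.1 hj), Matrix.mulVec_zero]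
  ext r i
  exact congrFun (key i) r

lemma comb1 {ι : Type*} [DecidableEq ι] (f : ι → ℕ) (m t : ℕ) (ht : 1 ≤ t) :
    ∀ S : Finset ι, S.card = t + m → ∑ r ∈ S, f r < S.card →
      ∃ T ⊆ S, T.card = t ∧ ∑ r ∈ T, f r < t := by
  induction m with
  | zero => intro S hS hf; exact ⟨S, subset_rfl, hS, by simpa [hS] using hf⟩
  | succ m ih =>
    intro S hS hf
    have : ∃ e ∈ S, ∑ r ∈ S.erase e, f r < (S.erase e).card := by
      by_cases h : ∃ e ∈ S, f e ≠ 0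
      · obtain ⟨e, he, h0⟩ := h
        refine ⟨e, he, ?_⟩
        have := Finset.add_sum_erase S f he
        rw [Finset.card_erase_of_mem he]
        omega
      · push Not at h
        have hne : S.Nonempty := Finset.card_pos.1 (by omega)
        obtain ⟨e, he⟩ := hne
        refine ⟨e, he, ?_⟩
        rw [Finset.card_erase_of_mem he,
          Finset.sum_eq_zero fun x hx => h x (Finset.mem_of_mem_erase hx)]
        omega
    obtain ⟨e, he, hlt⟩ := this
    obtain ⟨T, hT, h1, h2⟩ := ih (S.erase e) (by rw [Finset.card_erase_of_mem he]; omega) hlt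
    exact ⟨T, hT.trans (Finset.erase_subset _ _), h1, h2⟩

lemma comb2 {ι : Type*} [DecidableEq ι] (f : ι → ℕ) (t : ℕ) (ht : 1 ≤ t)
    (S : Finset ι) (hS : t < S.card) (hf : ∑ r ∈ S, f r ≤ S.card)
    (hT : ∀ T ⊆ S, T.card = t → t ≤ ∑ r ∈ T, f r) : ∀ r ∈ S, f r = 1 := by
  have hpos : ∀ r ∈ S, 1 ≤ f r := by
    intro z hz
    by_contra h0
    rcases hf.lt_or_eq with hlt | heq
    · obtain ⟨T, h1, h2, h3⟩ := comb1 f (S.card - t) t ht S (by omega) hlt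
      exact absurd (hT T h1 h2) (by omega)
    · have : ∃ e ∈ S, 2 ≤ f e := by
        by_contra hcon
        push Not at hcon
        have : ∑ r ∈ S, f r < ∑ r ∈ S, 1 :=
          Finset.sum_lt_sum (fun i hi => by have := hcon i hi; omega) ⟨z, hz, by omega⟩
        simp at this
        omega
      obtain ⟨e, he, h2e⟩ := this
      have hs := Finset.add_sum_erase S f he
      have hc := Finset.card_erase_of_mem he
      obtain ⟨T, h1, h2, h3⟩ := comb1 f (S.card - 1 - t) t ht (S.erase e) (by omega) (by omega)
      exact absurd (hT T (h1.trans (Finset.erase_subset _ _)) h2) (by omega)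
  intro r hr
  by_contra h
  have : ∑ r ∈ S, 1 < ∑ r ∈ S, f r :=
    Finset.sum_lt_sum hpos ⟨r, hr, by have := hpos r hr; omega⟩
  simp at this
  omega

lemma piggy_comb {n t k : ℕ} {K : Type*} [Field K] [Fintype K]
    {G : Matrix (Fin k) (Fin n) K} 
    {P : Fin t → Fin t → Matrix (Fin k) (Fin n) K} {W : Fin t → Matrix (Fin n) (Fin t) K}
    (hW : ∀ j, PiggyDual G P (W j)) (x : Fin t → K) : PiggyDual G P (∑ j, x j • W j) := by
  have hadd : ∀ A B, PiggyDual G P A → PiggyDual G P B → PiggyDual G P (A + B) := by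
    intro A B hA hB i
    have e : ∀ j, (fun r => (A + B) r j) = (fun r => A r j) + fun r => B r j := fun j => rfl
    simp only [e, Matrix.mulVec_add, Finset.sum_add_distrib]
    rw [add_add_add_comm, hA i, hB i, add_zero]
  have hsmul : ∀ (c : K) A, PiggyDual G P A → PiggyDual G P (c • A) := by
    intro c A hA i
    have e : ∀ j, (fun r => (c • A) r j) = c • (fun r => A r j) := fun j => rfl
    simp only [e, Matrix.mulVec_smul, ← Finset.smul_sum]
    rw [← smul_add, hA i, smul_zero]
  have h0 : PiggyDual G P (0 : Matrix (Fin n) (Fin t) K) := by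
    intro i
    have e : ∀ j, (fun r => (0 : Matrix (Fin n) (Fin t) K) r j) = 0 := fun j => rfl
    simp only [e, Matrix.mulVec_zero, Finset.sum_const_zero, add_zero]
  exact Finset.sum_induction _ _ hadd h0 fun j _ => hsmul _ _ (hW j)

/-- What one repair scheme at node `i` implies about the last two substripes. -/
lemma scheme {n t k : ℕ} {K : Type*} [Field K] [Fintype K]
    (hk : 2 ≤ k) (ht : 2 ≤ t) (hn : k + t ≤ n)
    {G : Matrix (Fin k) (Fin n) K} (hMDS : IsMDS G)
    {P : Fin t → Fin t → Matrix (Fin k) (Fin n) K} (i : Fin n) (S : Finset (Fin n))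
    (hS : S.card = k + t - 1) (hi : i ∉ S) (W : Fin t → Matrix (Fin n) (Fin t) K)
    (hW : ∀ j, PiggyDual G P (W j))
    (hsupp : ∀ (j) (r : Fin n), r ∉ S → r ≠ i → W j r = 0)
    (hfull : Module.finrank K (Submodule.span K (Set.range fun j => W j i)) = t)
    (hbw : ∑ r ∈ S, Module.finrank K (Submodule.span K (Set.range fun j => W j r)) ≤ k + t - 1)
    (a b : Fin t) (hab : Finset.Ioi a = {b}) (hb : Finset.Ioi b = ∅) :
    ∃ u : Fin n → K,
      (∀ y : Fin n → K, (∀ r, r ∉ S → r ≠ i → y r = 0) → G *ᵥ y = 0 →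
        ∃ c, G *ᵥ (u * y) + P a b *ᵥ y = G *ᵥ Pi.single i c) ∧
      ∃ y : Fin n → K, (∀ r, r ∉ S → r ≠ i → y r = 0) ∧ G *ᵥ y = 0 ∧ y i = 0 ∧
        ∃ c, c ≠ 0 ∧ G *ᵥ (u * y) + P a b *ᵥ y = G *ᵥ Pi.single i c := by
  classical
  have hkn : k ≤ n := by omega
  let R : Fin n → (Fin t → K) →ₗ[K] (Fin t → K) := fun r =>
    Fintype.linearCombination K (fun j => W j r)
  let Φ : (Fin t → K) → Matrix (Fin n) (Fin t) K := fun x => Matrix.of fun r => R r x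
  have hΦ : ∀ x, PiggyDual G P (Φ x) := by
    intro x
    have : Φ x = ∑ j, x j • W j := by
      ext r c
      simp [Φ, R, Fintype.linearCombination_apply, Finset.sum_apply, Matrix.sum_apply]
    rw [this]
    exact piggy_comb hW x
  have hrange : ∀ r, LinearMap.range (R r) = Submodule.span K (Set.range fun j => W j r) :=
    fun r => Fintype.range_linearCombination K _
  have hRsupp : ∀ x r, r ∉ S → r ≠ i → R r x = 0 := by
    intro x r h1 h2
    simp [R, Fintype.linearCombination_apply, hsupp _ r h1 h2]
  have hsurj : Function.Surjective (R i) := by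
    rw [← LinearMap.range_eq_top]
    apply Submodule.eq_top_of_finrank_eq
    rw [hrange, hfull]; simp
  have hinj : Function.Injective (R i) := LinearMap.injective_iff_surjective.2 hsurj
  have hD : (insert i S).card = k + t := by rw [Finset.card_insert_of_notMem hi]; omega
  -- vanishing on `t` helpers forces zero
  have hvan : ∀ x, ∀ T ⊆ S, T.card = t → (∀ r ∈ T, R r x = 0) → x = 0 := by
    intro x T hTS hTc hT
    have h0 : Φ x = 0 := by
      apply piggy_zero hMDS hkn (hΦ x) (insert i S \ T)
      · rw [Finset.card_sdiff_of_subset (hTS.trans (Finset.subset_insert _ _))]; omega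
      · intro r hr
        change R r x = 0
        by_cases hrT : r ∈ T
        · exact hT r hrT
        · have : r ∉ insert i S := fun h => hr (Finset.mem_sdiff.2 ⟨h, hrT⟩)
          rw [Finset.mem_insert, not_or] at this
          exact hRsupp x r this.2 this.1
    apply hinj
    rw [map_zero]
    exact congrFun h0 i
  have hex : ∀ T : Finset (Fin n), ∑ r ∈ T, Module.finrank K (LinearMap.range (R r)) < t →
      ∃ x, x ≠ 0 ∧ ∀ r ∈ T, R r x = 0 := by
    intro T hT
    let f : (Fin t → K) →ₗ[K] ((r : T) → LinearMap.range (R r)) :=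
      LinearMap.pi fun r => (R r).rangeRestrict
    have hker : LinearMap.ker f ≠ ⊥ := by
      apply LinearMap.ker_ne_bot_of_finrank_lt
      rw [Module.finrank_pi_fintype,
        Finset.sum_coe_sort T (fun r => Module.finrank K (LinearMap.range (R r)))]
      simpa using hT
    obtain ⟨x, hx, hx0⟩ := (Submodule.ne_bot_iff _).1 hker
    refine ⟨x, hx0, fun r hr => ?_⟩
    have := congrFun (LinearMap.mem_ker.1 hx) ⟨r, hr⟩
    exact congrArg Subtype.val this
  have hone : ∀ r ∈ S, Module.finrank K (LinearMap.range (R r)) = 1 := by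
    apply comb2 (fun r => Module.finrank K (LinearMap.range (R r))) t (by omega) S (by omega)
    · rw [hS]
      refine le_trans (le_of_eq (Finset.sum_congr rfl fun r _ => ?_)) hbw
      rw [hrange]
    · intro T hTS hTc
      by_contra hlt
      obtain ⟨x, hx0, hx⟩ := hex T (by omega)
      exact hx0 (hvan x T hTS hTc hx)
  have hv : ∀ r, ∃ v : Fin t → K, r ∈ S → ∀ x, ∃ c : K, R r x = c • v := by
    intro r
    by_cases hr : r ∈ S
    · obtain ⟨v, hv⟩ := finrank_le_one_iff.1 (hone r hr).le
      refine ⟨v, fun _ x => ?_⟩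
      obtain ⟨c, hc⟩ := hv ⟨R r x, LinearMap.mem_range_self _ _⟩
      exact ⟨c, (congrArg Subtype.val hc).symm⟩
    · exact ⟨0, fun h => absurd h hr⟩
  choose v hv using hv
  -- equation of the last column
  have hlast : ∀ x, G *ᵥ (fun r => R r x b) = 0 := by
    intro x
    have := hΦ x b
    rw [hb] at this
    simpa [Φ] using this
  have hvb : ∀ r ∈ S, v r b ≠ 0 := by
    intro r0 hr0 hz
    have hall : ∀ r ∈ S, v r b = 0 := by
      intro r hr
      by_cases hrr : r = r0
      · rw [hrr]; exact hz
      have hc2 : ((S.erase r0).erase r).card = k + t - 3 := by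
        rw [Finset.card_erase_of_mem (Finset.mem_erase.2 ⟨hrr, hr⟩),
          Finset.card_erase_of_mem hr0]; omega
      obtain ⟨T, hT, hTc⟩ := Finset.exists_subset_card_eq
        (s := (S.erase r0).erase r) (n := t - 1) (by omega)
      have hTS : T ⊆ S := hT.trans ((Finset.erase_subset _ _).trans (Finset.erase_subset _ _))
      have hr0T : r0 ∉ T := fun h => by simpa using hT h
      have hrT : r ∉ T := fun h => by simpa using hT h
      obtain ⟨x, hx0, hx⟩ := hex T (by
        rw [Finset.sum_congr rfl fun r hr => hone r (hTS hr)]; simp; omega)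
      have hcol : (fun r => R r x b) = 0 := by
        have hsub : insert r0 T ⊆ insert i S := by
          intro q hq
          rcases Finset.mem_insert.1 hq with rfl | hq
          · exact Finset.mem_insert_of_mem hr0
          · exact Finset.mem_insert_of_mem (hTS hq)
        apply mds_zero hMDS hkn _ (hlast x) (insert i S \ insert r0 T)
        · rw [Finset.card_sdiff_of_subset hsub, Finset.card_insert_of_notMem hr0T]; omega
        · intro q hq
          by_cases hqT : q ∈ insert r0 T
          · rcases Finset.mem_insert.1 hqT with rfl | hqT
            · obtain ⟨c, hc⟩ := hv q hr0 x
              simp [hc, hz]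
            · simp [hx q hqT]
          · have : q ∉ insert i S := fun h => hq (Finset.mem_sdiff.2 ⟨h, hqT⟩)
            rw [Finset.mem_insert, not_or] at this
            simp [hRsupp x q this.2 this.1]
      obtain ⟨c, hc⟩ := hv r hr x
      have h1 : c * v r b = 0 := by
        have := congrFun hcol r
        simpa [hc] using this
      rcases mul_eq_zero.1 h1 with h2 | h2
      · exfalso
        apply hx0
        apply hvan x (insert r T) (Finset.insert_subset hr hTS)
        · rw [Finset.card_insert_of_notMem hrT]; omega
        · intro q hq
          rcases Finset.mem_insert.1 hq with rfl | hq
          · rw [hc, h2, zero_smul]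
          · exact hx q hq
      · exact h2
    obtain ⟨x, hx⟩ := hsurj (Pi.single b 1)
    have hcol : (fun r => R r x b) = 0 := by
      apply mds_zero hMDS hkn _ (hlast x) {i} (by simp; omega)
      intro q hq
      by_cases hqS : q ∈ S
      · obtain ⟨c, hc⟩ := hv q hqS x
        simp [hc, hall q hqS]
      · simp [hRsupp x q hqS (by simpa using hq)]
    have := congrFun hcol i
    simp [hx] at this
  have hra : ∀ r ∈ S, ∀ x, R r x a = v r a / v r b * R r x b := by
    intro r hr x
    obtain ⟨c, hc⟩ := hv r hr x
    have := hvb r hr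
    simp [hc]
    field_simp
  let u : Fin n → K := fun r => if r ∈ S then v r a / v r b else 0
  have hcola : ∀ x, G *ᵥ (u * fun r => R r x b) + P a b *ᵥ (fun r => R r x b)
      = G *ᵥ Pi.single i (- R i x a) := by
    intro x
    have h1 := hΦ x a
    rw [hab, Finset.sum_singleton] at h1
    have h2 : (fun r => Φ x r a) = (u * fun r => R r x b) - Pi.single i (- R i x a) := by
      funext r
      change R r x a = _
      by_cases hr : r ∈ S
      · have : r ≠ i := fun h => hi (h ▸ hr)
        simp [u, hr, this, hra r hr x]
      · by_cases hri : r = i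
        · subst hri
          simp [u, hr]
        · simp [u, hr, hri, hRsupp x r hr hri]
    rw [h2, Matrix.mulVec_sub] at h1
    have h3 : G *ᵥ (u * fun r => R r x b) + P a b *ᵥ (fun r => R r x b)
      - G *ᵥ Pi.single i (- R i x a) = 0 := by
      rw [← h1]
      change _ = _ + P a b *ᵥ (fun r => R r x b)
      abel
    exact sub_eq_zero.1 h3
  refine ⟨u, ?_, ?_⟩
  · intro y hy hGy
    obtain ⟨T, hTS, hTc⟩ := Finset.exists_subset_card_eq (s := S) (n := t) (by omega)
    let f : (Fin t → K) →ₗ[K] (T → K) :=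
      LinearMap.pi fun r => (LinearMap.proj b) ∘ₗ R r
    have hf : Function.Injective f := by
      rw [injective_iff_map_eq_zero]
      intro x hx
      apply hvan x T hTS hTc
      intro r hr
      have h1 : R r x b = 0 := congrFun hx ⟨r, hr⟩
      obtain ⟨c, hc⟩ := hv r (hTS hr) x
      rw [hc] at h1
      have : c = 0 := by simpa [hvb r (hTS hr)] using h1
      rw [hc, this, zero_smul]
    have hfs : Function.Surjective f :=
      (LinearMap.injective_iff_surjective_of_finrank_eq_finrank (by simp [hTc])).1 hf
    obtain ⟨x, hx⟩ := hfs fun r => y r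
    have hyx : y = fun r => R r x b := by
      rw [← sub_eq_zero]
      apply mds_zero hMDS hkn _ _ (insert i S \ T)
      · rw [Finset.card_sdiff_of_subset (hTS.trans (Finset.subset_insert _ _))]; omega
      · intro r hr
        by_cases hrT : r ∈ T
        · have h1 : R r x b = y r := congrFun hx ⟨r, hrT⟩
          simp [h1]
        · have : r ∉ insert i S := fun h => hr (Finset.mem_sdiff.2 ⟨h, hrT⟩)
          rw [Finset.mem_insert, not_or] at this
          simp [hRsupp x r this.2 this.1, hy r this.2 this.1]
      · rw [Matrix.mulVec_sub, hGy, hlast, sub_zero]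
    exact ⟨- R i x a, by rw [hyx]; exact hcola x⟩
  · have hne : b ≠ a := by
      have : b ∈ Finset.Ioi a := by rw [hab]; simp
      exact (Finset.mem_Ioi.1 this).ne'
    obtain ⟨x, hx⟩ := hsurj (Pi.single a 1)
    refine ⟨fun r => R r x b, fun r h1 h2 => by simp [hRsupp x r h1 h2], hlast x, ?_,
      - R i x a, ?_, hcola x⟩
    · simp [hx, hne]
    · simp [hx]

end helpers

/-- for `k ≥ 3` no `(n,k)` piggybacking code with `t` substripes
achieves perfect bandwidth `k+t-1` in the "any d" regime: it is impossible that for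
every failed node `i*` and every repair set `S` of size `k+t-1` avoiding `i*` there
is a linear repair scheme (a set of `t` repair matrices in the dual, supported on
`S ∪ {i*}`, with full-dimensional row `i*`) of bandwidth `k+t-1`. -/
theorem no_perfect_bandwidth_any_d {n t k : ℕ} (K : Type*) [Field K] [Fintype K]
    (hk : 3 ≤ k) (ht : 2 ≤ t) (hn : k + t ≤ n)
    (G : Matrix (Fin k) (Fin n) K) (hMDS : IsMDS G)
    (P : Fin t → Fin t → Matrix (Fin k) (Fin n) K) :
    ¬ (∀ (istar : Fin n) (S : Finset (Fin n)), S.card = k + t - 1 → istar ∉ S →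
      ∃ W : Fin t → Matrix (Fin n) (Fin t) K,
        (∀ j, PiggyDual G P (W j)) ∧
        (∀ (j) (i : Fin n), i ∉ S → i ≠ istar → W j i = 0) ∧
        Module.finrank K (Submodule.span K (Set.range fun j => W j istar)) = t ∧
        ∑ i ∈ S,
          Module.finrank K (Submodule.span K (Set.range fun j => W j i))
            ≤ k + t - 1) := by
  classical
  intro H
  have hkn : k ≤ n := by omega
  obtain ⟨D, -, hD⟩ := Finset.exists_subset_card_eq
    (s := (Finset.univ : Finset (Fin n))) (n := k + t) (by simpa using hn)
  let a : Fin t := ⟨t - 2, by omega⟩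
  let b : Fin t := ⟨t - 1, by omega⟩
  have hab : Finset.Ioi a = {b} := by
    ext q
    simp only [Finset.mem_Ioi, Finset.mem_singleton, Fin.lt_def, Fin.ext_iff, a, b]
    have := q.2
    omega
  have hb : Finset.Ioi b = ∅ := by
    apply Finset.eq_empty_of_forall_notMem
    intro q hq
    have h0 : b < q := Finset.mem_Ioi.1 hq
    have h1 : t - 1 < q.1 := h0
    have := q.2
    omega
  have key : ∀ i ∈ D, ∃ u : Fin n → K,
      (∀ y : Fin n → K, (∀ r, r ∉ D → y r = 0) → G *ᵥ y = 0 →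
        ∃ c, G *ᵥ (u * y) + P a b *ᵥ y = G *ᵥ Pi.single i c) ∧
      ∃ y : Fin n → K, (∀ r, r ∉ D → y r = 0) ∧ G *ᵥ y = 0 ∧ y i = 0 ∧
        ∃ c, c ≠ 0 ∧ G *ᵥ (u * y) + P a b *ᵥ y = G *ᵥ Pi.single i c := by
    intro i hiD
    have hc : (D.erase i).card = k + t - 1 := by rw [Finset.card_erase_of_mem hiD, hD]
    have hni : i ∉ D.erase i := by simp
    obtain ⟨W, h1, h2, h3, h4⟩ := H i (D.erase i) hc hni
    obtain ⟨u, hu1, y, hy1, hy2⟩ :=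
      scheme (by omega) ht hn hMDS i (D.erase i) hc hni W h1 h2 h3 h4 a b hab hb
    have hmem : ∀ y : Fin n → K, (∀ r, r ∉ D → y r = 0) ↔
        (∀ r, r ∉ D.erase i → r ≠ i → y r = 0) := by
      intro y
      constructor
      · intro h r hr hri
        exact h r fun hrD => hr (Finset.mem_erase.2 ⟨hri, hrD⟩)
      · intro h r hr
        exact h r (fun h => hr (Finset.mem_of_mem_erase h)) (fun h => hr (h ▸ hiD))
    exact ⟨u, fun y hy => hu1 y ((hmem y).1 hy), y, (hmem y).2 hy1, hy2⟩
  obtain ⟨i, hi, j, hj, hij⟩ := Finset.one_lt_card.1 (show 1 < D.card by omega)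
  obtain ⟨ui, hui, y, hyD, hyG, hyi, c, hc0, hc⟩ := key i hi
  obtain ⟨uj, huj, -⟩ := key j hj
  have hconst : ∀ r ∈ (D.erase i).erase j, ∀ s ∈ (D.erase i).erase j,
      ui s - uj s = ui r - uj r := by
    intro r hr s hs
    by_cases hrs : s = r
    · rw [hrs]
    have hcE : ((((D.erase i).erase j).erase r).erase s).card = k + t - 4 := by
      rw [Finset.card_erase_of_mem (Finset.mem_erase.2 ⟨hrs, hs⟩), Finset.card_erase_of_mem hr,
        Finset.card_erase_of_mem (Finset.mem_erase.2 ⟨hij.symm, hj⟩), Finset.card_erase_of_mem hi]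
      omega
    obtain ⟨A, hA, hAc⟩ := Finset.exists_subset_card_eq
      (s := (((D.erase i).erase j).erase r).erase s) (n := t - 1) (by omega)
    have hA' : ∀ q ∈ A, q ≠ s ∧ q ≠ r ∧ q ≠ j ∧ q ≠ i ∧ q ∈ D := by
      intro q hq
      simpa using hA hq
    have hr' : r ≠ j ∧ r ≠ i ∧ r ∈ D := by simpa using hr
    have hs' : s ≠ j ∧ s ≠ i ∧ s ∈ D := by simpa using hs
    have hAD : A ⊆ D := fun q hq => (hA' q hq).2.2.2.2
    have hrA : r ∉ A := fun h => (hA' r h).2.1 rfl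
    -- vanishing at A and r
    have hz : ∀ w : Fin n → K, (∀ q, q ∉ D → w q = 0) → G *ᵥ w = 0 → (∀ q ∈ A, w q = 0) →
        w r = 0 → w = 0 := by
      intro w hwD hwG hwA hwr
      apply mds_zero hMDS hkn w hwG (D \ insert r A)
      · rw [Finset.card_sdiff_of_subset (Finset.insert_subset hr'.2.2 hAD),
          Finset.card_insert_of_notMem hrA]
        omega
      · intro q hq
        by_cases hqA : q ∈ insert r A
        · rcases Finset.mem_insert.1 hqA with rfl | hqA
          · exact hwr
          · exact hwA q hqA
        · exact hwD q fun h => hq (Finset.mem_sdiff.2 ⟨h, hqA⟩)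
    have hsA : s ∉ A := fun h => (hA' s h).1 rfl
    obtain ⟨w, hw0, hwG, hwS⟩ := exists_ker G (D \ A) (by
      rw [Finset.card_sdiff_of_subset hAD]; omega)
    have hwD : ∀ q, q ∉ D → w q = 0 := fun q hq => hwS q fun h => hq (Finset.mem_sdiff.1 h).1
    have hwA : ∀ q ∈ A, w q = 0 := fun q hq => hwS q fun h => (Finset.mem_sdiff.1 h).2 hq
    have hws : w s ≠ 0 := by
      intro h0
      apply hw0
      apply mds_zero hMDS hkn w hwG (D \ insert s A)
      · rw [Finset.card_sdiff_of_subset (Finset.insert_subset hs'.2.2 hAD),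
          Finset.card_insert_of_notMem hsA]
        omega
      · intro q hq
        by_cases hqA : q ∈ insert s A
        · rcases Finset.mem_insert.1 hqA with rfl | hqA
          · exact h0
          · exact hwA q hqA
        · exact hwD q fun h => hq (Finset.mem_sdiff.2 ⟨h, hqA⟩)
    obtain ⟨c1, h1⟩ := hui w hwD hwG
    obtain ⟨c2, h2⟩ := huj w hwD hwG
    have h3 := hz (ui * w - uj * w - Pi.single i c1 + Pi.single j c2 - (ui r - uj r) • w)
      (by
        intro q hq
        have e1 : q ≠ i := fun h => hq (h ▸ hi)
        have e2 : q ≠ j := fun h => hq (h ▸ hj)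
        simp [hwD q hq, e1, e2])
      (by
        rw [Matrix.mulVec_sub, Matrix.mulVec_add, Matrix.mulVec_sub, Matrix.mulVec_sub,
          Matrix.mulVec_smul, hwG, ← h1, ← h2, smul_zero]
        abel)
      (by
        intro q hq
        obtain ⟨-, -, e2, e1, -⟩ := hA' q hq
        simp [hwA q hq, e1, e2])
      (by
        simp [hr'.1, hr'.2.1]
        ring)
    have h4 := congrFun h3 s
    simp [hs'.1, hs'.2.1] at h4
    have h5 : (ui s - uj s - (ui r - uj r)) * w s = 0 := by rw [← h4]; ring
    rcases mul_eq_zero.1 h5 with h6 | h6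
    · exact sub_eq_zero.1 h6
    · exact absurd h6 hws
  have hne : ((D.erase i).erase j).Nonempty := by
    rw [← Finset.card_pos, Finset.card_erase_of_mem (Finset.mem_erase.2 ⟨hij.symm, hj⟩),
      Finset.card_erase_of_mem hi]
    omega
  obtain ⟨r, hr⟩ := hne
  obtain ⟨c2, h2⟩ := huj y hyD hyG
  set z := ui r - uj r with hzdef
  have hprod : ui * y = uj * y + z • y + Pi.single j ((ui j - uj j - z) * y j) := by
    funext q
    by_cases hqj : q = j
    · subst hqj
      simp
      ring
    · by_cases hqi : q = i
      · subst hqi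
        simp [hyi, hij]
      · by_cases hqD : q ∈ D
        · have := hconst r hr q (by simp [hqj, hqi, hqD])
          simp only [Pi.add_apply, Pi.mul_apply, Pi.smul_apply, smul_eq_mul,
            Pi.single_eq_of_ne hqj]
          rw [hzdef, ← this]
          ring
        · simp [hyD q hqD, hqj]
  have h7 : G *ᵥ (Pi.single i c - Pi.single j (c2 + (ui j - uj j - z) * y j)) = 0 := by
    rw [Matrix.mulVec_sub, ← hc, hprod, Pi.single_add, Matrix.mulVec_add, Matrix.mulVec_add,
      Matrix.mulVec_add, Matrix.mulVec_smul, hyG, ← h2, smul_zero]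
    abel
  have h8 := mds_zero hMDS hkn _ h7 {i, j} (by
    have := Finset.card_le_two (a := i) (b := j)
    omega) (by
    intro q hq
    have : q ≠ i ∧ q ≠ j := by simpa using hq
    simp [this.1, this.2])
  have h9 := congrFun h8 i
  simp [hij] at h9
  exact hc0 h9
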